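/- arXiv:1803.08755 — 2 statements merged into one kernel-verified Lean document; each statement's English description precedes it below -/
import Mathlib

section
/- Let d ≥ 4 be a composite integer and let ℓ be the smallest prime factor of d. Then D*_d(H) ≍ H^{d/ℓ + 1}, i.e. there exist constants c₁, c₂ > 0 (depending only on d) such that for all integers H ≥ 2, c₁·H^{d/ℓ + 1} ≤ D*_d(H) ≤ c₂·H^{d/ℓ + 1}. -/
open Polynomial

/-- The height of an integer polynomial is at most `H`. -/
def HeightLe (f : ℤ[X]) (H : ℕ) : Prop := ∀ i, |f.coeff i| ≤ (H : ℤ)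

/-- A polynomial is decomposable if it is a composition of two polynomials of degree `≥ 2`. -/
def Decomposable (f : ℤ[X]) : Prop :=
  ∃ g h : ℤ[X], 2 ≤ g.natDegree ∧ 2 ≤ h.natDegree ∧ f = g.comp h

/-- `DdStar d H` is the number of decomposable integer polynomials (not necessarily monic)
of degree `d` and height at most `H`. -/
noncomputable def DdStar (d : ℕ) (H : ℕ) : ℕ :=
  Nat.card {f : ℤ[X] // f.natDegree = d ∧ f ≠ 0 ∧ HeightLe f H ∧ Decomposable f}


lemma dec_key_root (n : ℕ) (h : ℂ[X]) (hn : h.natDegree = n) (h2 : 1 ≤ n) (h0 : h.coeff 0 = 0) (T : ℝ) (hT : 0 < T)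
    (j : ℕ) (hj : T = ‖h.coeff j‖) (b : ℂ) :
    (C (T : ℂ) * X - C b).mahlerMeasure ≤ 2 ^ n * (h - C b).mahlerMeasure := by
  have hj0 : j ≠ 0 := by
    rintro rfl
    simp [h0] at hj
    linarith
  have hb : ∀ i, ‖(h - C b).coeff i‖ ≤ 2 ^ n * (h - C b).mahlerMeasure := by
    intro i
    refine (norm_coeff_le_choose_mul_mahlerMeasure i _).trans ?_
    have : (h - C b).natDegree = n := by rw [natDegree_sub_C, hn]
    rw [this]
    have h3 : (n.choose i : ℝ) ≤ 2 ^ n := by exact_mod_cast Nat.choose_le_two_pow n i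
    have := mahlerMeasure_nonneg (h - C b)
    gcongr
  have e : C (T : ℂ) * X - C b = C (T : ℂ) * X + C (-b) := by simp [sub_eq_add_neg]
  rw [e, mahlerMeasure_C_mul_X_add_C (by exact_mod_cast hT.ne')]
  have h1 := hb j
  have h3 := hb 0
  rw [coeff_sub, coeff_C_of_ne_zero hj0, sub_zero, ← hj] at h1
  rw [coeff_sub, coeff_C_zero, h0, zero_sub] at h3
  refine max_le ?_ h3
  simpa [abs_of_pos hT] using h1

lemma dec_key_prod (n : ℕ) (h : ℂ[X]) (hn : h.natDegree = n) (h2 : 1 ≤ n) (h0 : h.coeff 0 = 0) (T : ℝ) (hT : 0 < T)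
    (j : ℕ) (hj : T = ‖h.coeff j‖) (G : ℂ[X]) :
    (G.comp (C (T : ℂ) * X)).mahlerMeasure ≤ (2 ^ n) ^ G.natDegree * (G.comp h).mahlerMeasure := by
  have hs : G.Splits := IsAlgClosed.splits G
  have hc : G.roots.card = G.natDegree := hs.natDegree_eq_card_roots.symm
  rw [← hc]
  have key : ∀ s : Multiset ℂ, ((s.map (fun a => X - C a)).prod.comp (C (T : ℂ) * X)).mahlerMeasure ≤
      (2 ^ n) ^ s.card * ((s.map (fun a => X - C a)).prod.comp h).mahlerMeasure := by
    intro s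
    induction s using Multiset.induction_on with
    | empty => simp
    | cons a s ih =>
      simp only [Multiset.map_cons, Multiset.prod_cons, mul_comp, mahlerMeasure_mul, Multiset.card_cons,
        sub_comp, X_comp, C_comp]
      have := dec_key_root n h hn h2 h0 T hT j hj a
      have p1 := mahlerMeasure_nonneg (h - C a)
      have p2 := mahlerMeasure_nonneg ((s.map (fun a => X - C a)).prod.comp (C (T : ℂ) * X))
      calc _ ≤ _ := mul_le_mul this ih p2 (by positivity)
        _ = _ := by ring
  have := key G.roots
  have e := hs.eq_prod_roots
  conv_lhs => rw [e]
  conv_rhs => enter [2]; rw [e]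
  simp only [mul_comp, C_comp, mahlerMeasure_mul, mahlerMeasure_const]
  calc _ ≤ _ := mul_le_mul_of_nonneg_left this (norm_nonneg _)
    _ = _ := by ring

lemma dec_key (m n : ℕ) (g h : ℤ[X]) (hm : g.natDegree = m) (hn : h.natDegree = n) (h2 : 1 ≤ n)
    (h0 : h.coeff 0 = 0) (T : ℝ) (hT : 0 < T) (j : ℕ) (hj : T = |(h.coeff j : ℝ)|) (H : ℕ)
    (hH : ∀ i, |(g.comp h).coeff i| ≤ (H : ℤ)) (i : ℕ) :
    |(g.coeff i : ℝ)| * T ^ i ≤ (2 ^ m * (2 ^ n) ^ m * (m * n + 1)) * H := by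
  set φ := Int.castRingHom ℂ with hφ
  have hinj : Function.Injective φ := Int.cast_injective
  have hgd : (g.map φ).natDegree = m := by rw [natDegree_map_eq_of_injective hinj, hm]
  have hhd : (h.map φ).natDegree = n := by rw [natDegree_map_eq_of_injective hinj, hn]
  have k1 := dec_key_prod n (h.map φ) hhd h2 (by simp [h0]) T hT j (by simp [hj]) (g.map φ)
  have k2 := norm_coeff_le_choose_mul_mahlerMeasure i ((g.map φ).comp (C (T : ℂ) * X))
  have k3 := mahlerMeasure_le_sum_norm_coeff ((g.map φ).comp (h.map φ))
  have hfd : ((g.map φ).comp (h.map φ)).natDegree = m * n := by rw [natDegree_comp, hgd, hhd]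
  have k4 : (((g.map φ).comp (h.map φ)).sum fun _ a ↦ ‖a‖) ≤ (m * n + 1) * H := by
    rw [sum_over_range _ (by simp), hfd]
    refine (Finset.sum_le_card_nsmul _ _ (H : ℝ) ?_).trans ?_
    · intro k _
      rw [← map_comp, coeff_map]
      have := hH k
      simp only [hφ, eq_intCast, Complex.norm_intCast]
      exact_mod_cast this
    · simp
  have hd : ((g.map φ).comp (C (T : ℂ) * X)).natDegree = m := by
    rw [natDegree_comp, hgd, natDegree_C_mul_X _ (by exact_mod_cast hT.ne'), mul_one]
  rw [hd, comp_C_mul_X_coeff, coeff_map, norm_mul, norm_pow] at k2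
  simp only [hφ, eq_intCast, Complex.norm_intCast, Complex.norm_real, Real.norm_eq_abs, abs_of_pos hT] at k2
  have h3 : (m.choose i : ℝ) ≤ 2 ^ m := by exact_mod_cast Nat.choose_le_two_pow m i
  rw [hgd] at k1
  have p := mahlerMeasure_nonneg ((g.map φ).comp (C (T : ℂ) * X))
  calc _ ≤ _ := k2
    _ ≤ 2 ^ m * ((2 ^ n) ^ m * ((m * n + 1) * H)) := by
      refine mul_le_mul h3 (k1.trans ?_) p (by positivity)
      have := k3.trans k4
      gcongr
    _ = _ := by ring

lemma dec_summable (n : ℕ) : Summable fun h : Fin n → ℤ => (‖h‖⁻¹) ^ (n + 1) := by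
  let B := Pi.basisFun ℝ (Fin n)
  let L : Submodule ℤ (Fin n → ℝ) := Submodule.span ℤ (Set.range B)
  let b : Module.Basis (Fin n) ℤ L := B.restrictScalars ℤ
  have hr : Module.finrank ℤ L = n := by
    rw [Module.finrank_eq_card_basis b]; simp
  have hs := ZLattice.summable_norm_pow_inv L (n + 1) (by omega)
  have := hs.comp_injective (b.equivFun.symm.injective)
  refine this.congr ?_
  intro h
  simp only [Function.comp]
  congr 2
  have : ((b.equivFun.symm h : L) : Fin n → ℝ) = fun i => (h i : ℝ) := by
    rw [Module.Basis.equivFun_symm_apply]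
    ext i
    have hb : ∀ x, ((b x : L) : Fin n → ℝ) = Pi.single x 1 := by
      intro x
      rw [show ((b x : L) : Fin n → ℝ) = B x from Module.Basis.restrictScalars_apply ℤ B x]
      simp [B]
    simp [Finset.sum_apply, Pi.single_apply, hb]
  rw [← Submodule.norm_coe, this]
  simp [Pi.norm_def]
  rfl

lemma dec_int_count (B : ℝ) (hB : 1 ≤ B) : ((Finset.Icc (-⌊B⌋) ⌊B⌋).card : ℝ) ≤ 3 * B := by
  have h0 : (0 : ℤ) ≤ ⌊B⌋ := Int.floor_nonneg.mpr (by linarith)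
  rw [Int.card_Icc]
  have : (((⌊B⌋ + 1 - -⌊B⌋).toNat : ℤ) : ℝ) = 2 * ⌊B⌋ + 1 := by
    rw [Int.toNat_of_nonneg (by omega)]; push_cast; ring
  have e : (((⌊B⌋ + 1 - -⌊B⌋).toNat : ℕ) : ℝ) = 2 * ⌊B⌋ + 1 := by exact_mod_cast this
  rw [e]
  have := Int.floor_le B
  linarith

lemma dec_mem_Icc (B : ℝ) (a : ℤ) (h : |(a : ℝ)| ≤ B) : a ∈ Finset.Icc (-⌊B⌋) ⌊B⌋ := by
  rw [abs_le] at h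
  have h1 : a ≤ ⌊B⌋ := Int.le_floor.mpr h.2
  have h2 : -a ≤ ⌊B⌋ := Int.le_floor.mpr (by push_cast; linarith)
  rw [Finset.mem_Icc]; omega

lemma dec_one_le_norm (n : ℕ) (h : Fin n → ℤ) (hh : h ≠ 0) : 1 ≤ ‖h‖ := by
  obtain ⟨j, hj⟩ := Function.ne_iff.mp hh
  refine le_trans ?_ (norm_le_pi_norm h j)
  rw [Int.norm_eq_abs]
  exact_mod_cast Int.one_le_abs hj

lemma dec_exp (m n K : ℕ) (hm : 2 ≤ m) (hmK : m ≤ K) (hnK : n ≤ K) :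
    n + 1 ≤ m * (K - m) + ∑ i ∈ Finset.range (m + 1), i := by
  obtain ⟨k, rfl⟩ := Nat.exists_eq_add_of_le hm
  obtain ⟨r, rfl⟩ := Nat.exists_eq_add_of_le hmK
  rw [Finset.sum_range_succ, show 2 + k = k + 1 + 1 by ring, Finset.sum_range_succ]
  have : k + 1 + 1 + r - (k + 1 + 1) = r := by omega
  rw [this]
  have h : r ≤ (k + 1 + 1) * r := by nlinarith
  have h3 : 0 ≤ ∑ i ∈ Finset.range (k + 1), i := Nat.zero_le _
  omega

lemma dec_count (m n K : ℕ) (hm : 2 ≤ m) (hmK : m ≤ K) (hnK : n ≤ K) (B : ℝ) (hB : 1 ≤ B) :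
    ∃ F : Finset (Σ _ : Fin n → ℤ, Fin (m + 1) → ℤ),
      (∀ h a, h ≠ 0 → a (Fin.last m) ≠ 0 → (∀ i : Fin (m + 1), |(a i : ℝ)| * ‖h‖ ^ (i : ℕ) ≤ B) →
        (⟨h, a⟩ : Σ _ : Fin n → ℤ, Fin (m + 1) → ℤ) ∈ F) ∧
      (F.card : ℝ) ≤ (3 * B) ^ (K + 1) * ∑' h : Fin n → ℤ, (‖h‖⁻¹) ^ (n + 1) := by
  classical
  let Fh : Finset (Fin n → ℤ) := (Fintype.piFinset (fun _ : Fin n => Finset.Icc (-⌊B⌋) ⌊B⌋)).filter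
    (fun h => h ≠ 0 ∧ ‖h‖ ^ m ≤ B)
  refine ⟨Fh.sigma (fun h => Fintype.piFinset
    (fun i : Fin (m + 1) => Finset.Icc (-⌊B / ‖h‖ ^ (i : ℕ)⌋) ⌊B / ‖h‖ ^ (i : ℕ)⌋)), ?_, ?_⟩
  · intro h a hh ha hi
    have hT := dec_one_le_norm n h hh
    have hTm : ‖h‖ ^ m ≤ B := by
      have h1 : (1 : ℝ) ≤ |(a (Fin.last m) : ℝ)| := by exact_mod_cast Int.one_le_abs ha
      have h2 := hi (Fin.last m)
      rw [Fin.val_last] at h2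
      have : 0 ≤ ‖h‖ ^ m := by positivity
      nlinarith
    rw [Finset.mem_sigma]
    refine ⟨?_, ?_⟩
    · simp only [Fh, Finset.mem_filter, Fintype.mem_piFinset]
      refine ⟨fun j => dec_mem_Icc B _ ?_, hh, hTm⟩
      have h1 := norm_le_pi_norm h j
      rw [Int.norm_eq_abs] at h1
      exact h1.trans ((le_self_pow₀ hT (by omega)).trans hTm)
    · simp only [Fintype.mem_piFinset]
      intro i
      apply dec_mem_Icc
      rw [le_div_iff₀ (by positivity)]
      exact hi i
  · rw [Finset.card_sigma, Nat.cast_sum]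
    have hsum := (dec_summable n).sum_le_tsum Fh (fun _ _ => by positivity)
    calc _ ≤ ∑ h ∈ Fh, (3 * B) ^ (K + 1) * (‖h‖⁻¹) ^ (n + 1) := by
          apply Finset.sum_le_sum
          intro h hmem
          simp only [Fh, Finset.mem_filter] at hmem
          obtain ⟨-, hh, hTm⟩ := hmem
          have hT := dec_one_le_norm n h hh
          rw [Fintype.card_piFinset, Nat.cast_prod]
          set T := ‖h‖
          have hT0 : 0 < T := by linarith
          calc _ ≤ ∏ i : Fin (m + 1), (3 * B) * (T⁻¹) ^ (i : ℕ) := by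
                apply Finset.prod_le_prod
                · intros; positivity
                · intro i _
                  refine (dec_int_count _ ?_).trans ?_
                  · rw [le_div_iff₀ (by positivity), one_mul]
                    exact (pow_le_pow_right₀ hT (by omega)).trans hTm
                  · rw [inv_pow]; apply le_of_eq; ring
            _ = (3 * B) ^ (m + 1) * (T⁻¹) ^ (∑ i ∈ Finset.range (m + 1), i) := by
                rw [Fin.prod_univ_eq_prod_range (fun i => (3 * B) * (T⁻¹) ^ i) (m + 1),
                  Finset.prod_mul_distrib, Finset.prod_pow_eq_pow_sum]
                simp
            _ ≤ (3 * B) ^ (m + 1) * (T⁻¹) ^ (∑ i ∈ Finset.range (m + 1), i) *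
                  ((3 * B) * (T⁻¹) ^ m) ^ (K - m) := by
                apply le_mul_of_one_le_right (by positivity)
                apply one_le_pow₀
                rw [inv_pow, ← div_eq_mul_inv, le_div_iff₀ (by positivity)]
                linarith
            _ = (3 * B) ^ (m + 1 + (K - m)) * (T⁻¹) ^ (m * (K - m) + ∑ i ∈ Finset.range (m + 1), i) := by
                rw [mul_pow (3 * B), pow_add (3 * B), pow_add T⁻¹, ← pow_mul]; ring
            _ ≤ (3 * B) ^ (K + 1) * (T⁻¹) ^ (n + 1) := by
                rw [show m + 1 + (K - m) = K + 1 by omega]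
                apply mul_le_mul_of_nonneg_left _ (by positivity)
                exact pow_le_pow_of_le_one (by positivity) (inv_le_one_of_one_le₀ hT) (dec_exp m n K hm hmK hnK)
      _ = (3 * B) ^ (K + 1) * ∑ h ∈ Fh, (‖h‖⁻¹) ^ (n + 1) := by rw [Finset.mul_sum]
      _ ≤ _ := by gcongr

noncomputable def decMap (m n : ℕ) (p : Σ _ : Fin n → ℤ, Fin (m + 1) → ℤ) : ℤ[X] :=
  (∑ i : Fin (m + 1), C (p.2 i) * X ^ (i : ℕ)).comp (∑ j : Fin n, C (p.1 j) * X ^ ((j : ℕ) + 1))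

lemma dec_repr (d H : ℕ) (f : ℤ[X]) (hfd : f.natDegree = d) (hH : HeightLe f H) (hf : Decomposable f) :
    ∃ m n, 2 ≤ m ∧ 2 ≤ n ∧ m * n = d ∧ ∃ h a, decMap m n ⟨h, a⟩ = f ∧ h ≠ 0 ∧ a (Fin.last m) ≠ 0 ∧
      ∀ i : Fin (m + 1), |(a i : ℝ)| * ‖h‖ ^ (i : ℕ) ≤ (2 ^ m * (2 ^ n) ^ m * (m * n + 1)) * H := by
  obtain ⟨g, h, hg2, hh2, rfl⟩ := hf
  set h' := h - C (h.coeff 0) with hh'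
  set g' := g.comp (X + C (h.coeff 0)) with hg'
  have hcomp : g'.comp h' = g.comp h := by
    rw [hg', comp_assoc]; simp [hh']
  have hgd : g'.natDegree = g.natDegree := by rw [hg', natDegree_comp, natDegree_X_add_C, mul_one]
  have hhd : h'.natDegree = h.natDegree := by rw [hh', natDegree_sub_C]
  have h0 : h'.coeff 0 = 0 := by simp [hh']
  rw [← hcomp] at hfd hH ⊢
  rw [← hgd] at hg2
  rw [← hhd] at hh2
  clear_value g' h'
  set m := g'.natDegree with hm
  set n := h'.natDegree with hn
  rw [natDegree_comp] at hfd
  let a : Fin (m + 1) → ℤ := fun i => g'.coeff i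
  let b : Fin n → ℤ := fun j => h'.coeff (j + 1)
  have hb : b ≠ 0 := by
    intro hb
    have := congrFun hb ⟨n - 1, by omega⟩
    simp only [b, Pi.zero_apply] at this
    rw [show n - 1 + 1 = n by omega, hn, coeff_natDegree, leadingCoeff_eq_zero] at this
    rw [this] at hn
    simp at hn
    omega
  refine ⟨m, n, hg2, hh2, hfd, b, a, ?_, hb, ?_, ?_⟩
  · simp only [decMap, a, b]
    congr 1
    · rw [Fin.sum_univ_eq_sum_range (fun i => C (g'.coeff i) * X ^ i) (m + 1)]
      exact (as_sum_range_C_mul_X_pow g').symm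
    · rw [Fin.sum_univ_eq_sum_range (fun i => C (h'.coeff (i + 1)) * X ^ (i + 1)) n]
      conv_rhs => rw [as_sum_range_C_mul_X_pow h', Finset.sum_range_succ', h0]
      simp [hn]
  · simp only [a, Fin.val_last, hm, coeff_natDegree]
    rw [Ne, leadingCoeff_eq_zero]
    intro h
    rw [h] at hm
    simp at hm
    omega
  · intro i
    have : Nonempty (Fin n) := ⟨⟨0, by omega⟩⟩
    obtain ⟨j, hj⟩ := Finite.exists_max (fun j => ‖b j‖)
    have hT : ‖b‖ = ‖b j‖ :=
      le_antisymm ((pi_norm_le_iff_of_nonneg (norm_nonneg _)).mpr hj) (norm_le_pi_norm b j)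
    have h1 := dec_one_le_norm n b hb
    exact dec_key m n g' h' hm.symm hn.symm (by omega) h0 ‖b‖ (by linarith) (j + 1)
      (by rw [hT, Int.norm_eq_abs]) H hH i

lemma dec_le (d m n : ℕ) (hn : 2 ≤ n) (hm : 2 ≤ m) (h : m * n = d) : m ≤ d / d.minFac := by
  have hd : n ∣ d := ⟨m, by rw [← h]; ring⟩
  rw [Nat.le_div_iff_mul_le (Nat.minFac_pos d), ← h]
  apply Nat.mul_le_mul_left
  rw [h]
  exact Nat.minFac_le_of_dvd hn hd

lemma dec_upper (d : ℕ) (hd : 4 ≤ d) : ∃ c₂ : ℝ, 0 < c₂ ∧ ∀ H : ℕ, 2 ≤ H →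
    ∃ F : Finset ℤ[X], (∀ f : ℤ[X], f.natDegree = d → HeightLe f H → Decomposable f → f ∈ F) ∧
      (F.card : ℝ) ≤ c₂ * (H : ℝ) ^ (d / d.minFac + 1) := by
  classical
  set L := d / d.minFac with hL
  let A : ℝ := 2 ^ d * 2 ^ d * (d + 1)
  have hA : 1 ≤ A := by
    have h1 : (1 : ℝ) ≤ 2 ^ d := one_le_pow₀ (by norm_num)
    have h2 : (1 : ℝ) ≤ d + 1 := by linarith [Nat.cast_nonneg (α := ℝ) d]
    exact one_le_mul_of_one_le_of_one_le (one_le_mul_of_one_le_of_one_le h1 h1) h2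
  let S : ℝ := ∑ p ∈ d.divisorsAntidiagonal, ∑' h : Fin p.2 → ℤ, (‖h‖⁻¹) ^ (p.2 + 1)
  have hS : 0 ≤ S := Finset.sum_nonneg fun p _ => tsum_nonneg fun h => by positivity
  refine ⟨(3 * A) ^ (L + 1) * (S + 1), by positivity, ?_⟩
  intro H hH
  have hHR : (1 : ℝ) ≤ H := by exact_mod_cast (by omega : 1 ≤ H)
  have hB : 1 ≤ A * H := one_le_mul_of_one_le_of_one_le hA hHR
  have ex : ∀ p : ℕ × ℕ, ∃ F : Finset (Σ _ : Fin p.2 → ℤ, Fin (p.1 + 1) → ℤ),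
      (2 ≤ p.1 → 2 ≤ p.2 → p.1 * p.2 = d → ∀ h a, h ≠ 0 → a (Fin.last p.1) ≠ 0 →
        (∀ i : Fin (p.1 + 1), |(a i : ℝ)| * ‖h‖ ^ (i : ℕ) ≤ A * H) →
        (⟨h, a⟩ : Σ _ : Fin p.2 → ℤ, Fin (p.1 + 1) → ℤ) ∈ F) ∧
      (F.card : ℝ) ≤ (3 * (A * H)) ^ (L + 1) * ∑' h : Fin p.2 → ℤ, (‖h‖⁻¹) ^ (p.2 + 1) := by
    rintro ⟨m, n⟩
    by_cases hc : 2 ≤ m ∧ 2 ≤ n ∧ m * n = d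
    · obtain ⟨hm, hn, hmn⟩ := hc
      obtain ⟨F, h1, h2⟩ := dec_count m n L hm (dec_le d m n hn hm hmn)
        (dec_le d n m hm hn (by rw [mul_comm]; exact hmn)) (A * H) hB
      exact ⟨F, fun _ _ _ => h1, h2⟩
    · refine ⟨∅, fun h1 h2 h3 => absurd ⟨h1, h2, h3⟩ hc, ?_⟩
      have : 0 ≤ ∑' h : Fin n → ℤ, (‖h‖⁻¹) ^ (n + 1) := tsum_nonneg fun h => by positivity
      simp only [Finset.card_empty, Nat.cast_zero]
      positivity
  choose F hF1 hF2 using ex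
  refine ⟨d.divisorsAntidiagonal.biUnion (fun p => (F p).image (decMap p.1 p.2)), ?_, ?_⟩
  · intro f hfd hfH hf
    obtain ⟨m, n, hm, hn, hmn, h, a, hfe, hh, ha, hi⟩ := dec_repr d H f hfd hfH hf
    rw [Finset.mem_biUnion]
    refine ⟨(m, n), Nat.mem_divisorsAntidiagonal.mpr ⟨hmn, by omega⟩, ?_⟩
    rw [Finset.mem_image]
    refine ⟨⟨h, a⟩, hF1 (m, n) hm hn hmn h a hh ha ?_, hfe⟩
    intro i
    refine (hi i).trans ?_
    have hmd : m ≤ d := by nlinarith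
    have e1 : ((2 : ℝ) ^ n) ^ m = 2 ^ d := by rw [← pow_mul, mul_comm n m, hmn]
    have e2 : (m * n : ℝ) = d := by exact_mod_cast hmn
    rw [e1, e2]
    have : (2 : ℝ) ^ m ≤ 2 ^ d := pow_le_pow_right₀ (by norm_num) hmd
    simp only [A]
    gcongr
  · calc _ ≤ ((∑ p ∈ d.divisorsAntidiagonal, (F p).card : ℕ) : ℝ) := by
          exact_mod_cast Finset.card_biUnion_le.trans (Finset.sum_le_sum fun p _ => Finset.card_image_le)
      _ ≤ (3 * (A * H)) ^ (L + 1) * S := by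
          rw [Nat.cast_sum, Finset.mul_sum]
          exact Finset.sum_le_sum fun p _ => hF2 p
      _ ≤ (3 * (A * H)) ^ (L + 1) * (S + 1) := by gcongr; linarith
      _ = _ := by rw [← mul_assoc, mul_pow]; ring

lemma dec_lower (d : ℕ) (hd : 4 ≤ d) (hcomp : ¬ Nat.Prime d) (H : ℕ) :
    ∃ φ : (Fin (d / d.minFac + 1) → Fin H) → ℤ[X], Function.Injective φ ∧
      ∀ a, (φ a).natDegree = d ∧ φ a ≠ 0 ∧ HeightLe (φ a) H ∧ Decomposable (φ a) := by
  set l := d.minFac with hl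
  set L := d / l with hL
  have hlp : l.Prime := Nat.minFac_prime (by omega)
  have hdl : L * l = d := Nat.div_mul_cancel (Nat.minFac_dvd d)
  have hL2 : 2 ≤ L := by
    by_contra hlt
    have : L = 0 ∨ L = 1 := Nat.le_one_iff_eq_zero_or_eq_one.mp (Nat.le_of_lt_succ (not_le.mp hlt))
    rcases this with h | h
    · rw [h, zero_mul] at hdl; omega
    · rw [h, one_mul] at hdl; rw [hdl] at hlp; exact hcomp hlp
  let G : (Fin (L + 1) → Fin H) → ℤ[X] := fun a => ∑ i : Fin (L + 1), C (((a i : ℕ) : ℤ) + 1) * X ^ (i : ℕ)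
  have hco : ∀ a (k : ℕ), (G a).coeff k = if h : k < L + 1 then (((a ⟨k, h⟩ : ℕ) : ℤ) + 1) else 0 := by
    intro a k
    simp only [G, finsetSum_coeff, coeff_C_mul, coeff_X_pow]
    split_ifs with h
    · rw [Finset.sum_eq_single ⟨k, h⟩]
      · simp
      · intro i _ hi
        have : k ≠ i := fun e => hi (by ext; exact e.symm)
        simp [this]
      · simp
    · apply Finset.sum_eq_zero
      intro i _
      have : k ≠ i := by have := i.2; omega
      simp [this]
  have hdeg : ∀ a, (G a).natDegree = L := by
    intro a
    apply natDegree_eq_of_le_of_coeff_ne_zero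
    · rw [natDegree_le_iff_coeff_eq_zero]
      intro k hk
      rw [hco, dif_neg (by omega)]
    · rw [hco, dif_pos (by omega)]; omega
  refine ⟨fun a => expand ℤ l (G a), ?_, ?_⟩
  · intro a b hab
    have h1 : G a = G b := expand_injective hlp.pos hab
    funext i
    have h2 := congrArg (fun p => coeff p (i : ℕ)) h1
    simp only [hco, i.2, dif_pos, Fin.eta] at h2
    ext
    omega
  · intro a
    have hd1 : (expand ℤ l (G a)).natDegree = d := by rw [natDegree_expand, hdeg, hdl]
    refine ⟨hd1, ?_, ?_, ?_⟩
    · intro h; beta_reduce at h; rw [h] at hd1; simp at hd1; omega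
    · intro i
      rw [coeff_expand hlp.pos]
      split_ifs
      · rw [hco]
        split_ifs with h
        · have := (a ⟨i / l, h⟩).2
          rw [abs_of_nonneg (by omega)]; omega
        · simp
      · simp
    · exact ⟨G a, X ^ l, by rw [hdeg]; exact hL2, by rw [natDegree_X_pow]; exact hlp.two_le, expand_eq_comp_X_pow l⟩

theorem stmt_11 (d : ℕ) (hd : 4 ≤ d) (hcomp : ¬ Nat.Prime d) :
    ∃ c₁ c₂ : ℝ, 0 < c₁ ∧ 0 < c₂ ∧ ∀ H : ℕ, 2 ≤ H →
      c₁ * (H : ℝ) ^ (d / d.minFac + 1) ≤ (DdStar d H : ℝ) ∧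
      (DdStar d H : ℝ) ≤ c₂ * (H : ℝ) ^ (d / d.minFac + 1) := by
  obtain ⟨c₂, hc, hup⟩ := dec_upper d hd
  refine ⟨1, c₂, one_pos, hc, ?_⟩
  intro H hH
  obtain ⟨F, hF, hcard⟩ := hup H hH
  let ι : {f : ℤ[X] // f.natDegree = d ∧ f ≠ 0 ∧ HeightLe f H ∧ Decomposable f} → F :=
    fun f => ⟨f.1, hF f.1 f.2.1 f.2.2.2.1 f.2.2.2.2⟩
  have hι : Function.Injective ι := by
    intro f g hfg
    apply Subtype.ext
    exact congrArg (fun x : F => (x : ℤ[X])) hfg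
  have hfin := Finite.of_injective ι hι
  constructor
  · obtain ⟨φ, hφ, hp⟩ := dec_lower d hd hcomp H
    have := Nat.card_le_card_of_injective
      (fun a => (⟨φ a, hp a⟩ : {f : ℤ[X] // f.natDegree = d ∧ f ≠ 0 ∧ HeightLe f H ∧ Decomposable f}))
      (fun a b hab => hφ (congrArg Subtype.val hab))
    rw [Nat.card_eq_fintype_card, Fintype.card_fun, Fintype.card_fin, Fintype.card_fin] at this
    rw [one_mul]
    exact_mod_cast this
  · have := Nat.card_le_card_of_injective ι hι
    rw [Nat.card_eq_fintype_card (α := F), Fintype.card_coe] at this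
    refine le_trans ?_ hcard
    exact_mod_cast this
end

section
/- There exists a constant c > 0 such that for all integers H ≥ 2, |D*_6(H) - I*_6(H)| ≤ c·H³·log H, where D*_6(H) is the number of decomposable polynomials in ℤ[x] of degree 6 and height at most H, I*_6(H) is the number of polynomials f ∈ ℤ[x] of degree 6 and height at most H such that f = g∘h for some indecomposable polynomials g, h ∈ ℤ[x] with deg g = 3 and deg h = 2, and log denotes the natural logarithm. -/
open Polynomial

/-- `IdStar d e H` is the number of integer polynomials of degree `d` and height at
most `H` which are compositions `g ∘ h` of indecomposable polynomials with
`deg g = d / e` and `deg h = e`. -/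
noncomputable def IdStar (d e : ℕ) (H : ℕ) : ℕ :=
  Nat.card {f : ℤ[X] // f.natDegree = d ∧ f ≠ 0 ∧ HeightLe f H ∧
    ∃ g h : ℤ[X], ¬ Decomposable g ∧ ¬ Decomposable h ∧
      g.natDegree = d / e ∧ h.natDegree = e ∧ f = g.comp h}

lemma key_norm (p q r B : ℝ) (h6 : |p^2| ≤ 1) (h5 : |2*p*q| ≤ 1) (h4 : |q^2+2*p*r| ≤ 1)
    (h3 : |2*q*r+B*p| ≤ 1) (h2 : |r^2+B*q| ≤ 1) (h1 : |B*r| ≤ 1) :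
    q^2 ≤ 5 ∧ r^2 ≤ 4 ∧ |B*p| ≤ 10 ∧ |B*q| ≤ 5 := by
  have hp : |p| ≤ 1 := by
    rw [abs_le]; rw [abs_le] at h6; constructor <;> nlinarith
  have hr : |r| ≤ 2 := by
    by_contra hr
    push Not at hr
    have e1 : |B| * |r| ≤ 1 := by rw [← abs_mul]; exact h1
    have e2 : |r|^2 ≤ 1 + |B| * |q| := by
      rw [← abs_mul]
      have := abs_le.1 h2
      have := neg_abs_le (B*q)
      rw [sq_abs]; linarith
    have e4 : |q|^2 ≤ 1 + 2*(|p| *|r|) := by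
      rw [← abs_mul]
      have := abs_le.1 h4
      have := neg_abs_le (p*r)
      rw [sq_abs]; linarith
    have e4' : 2*(|p| *|r|) ≥ |q|^2 - 1 := by
      linarith
    have e5 : 2*|p| *|q| ≤ 1 := by
      have : |2*p*q| = 2*|p| *|q| := by rw [abs_mul, abs_mul]; norm_num
      linarith
    have e4'' : |q|^2 - 1 ≤ 2*(|p| *|r|) := e4'
    have hq0 := abs_nonneg q
    have hB0 := abs_nonneg B
    have hp0 := abs_nonneg p
    generalize |q| = y at *
    generalize |r| = z at *
    generalize |B| = w at *
    generalize |p| = x at *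
    -- w z ≤ 1, z^2 ≤ 1 + w y, so z^3 ≤ z + y
    have f1 : z^3 ≤ z + y := by nlinarith
    have f2 : y ≥ 6 := by nlinarith
    have f3 : y * (y^2-1) ≤ z := by
      have : y * (y^2-1) ≤ y * (2*(x*z)) := mul_le_mul_of_nonneg_left e4'' hq0
      nlinarith
    have f4 : z ≥ 35 * y := by nlinarith
    nlinarith
  have hr2 : r^2 ≤ 4 := by rw [← sq_abs]; nlinarith [abs_nonneg r]
  have hpr : |p*r| ≤ 2 := by rw [abs_mul]; nlinarith [abs_nonneg r, abs_nonneg p]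
  have hq2 : q^2 ≤ 5 := by linarith [abs_le.1 hpr, abs_le.1 h4]
  refine ⟨hq2, hr2, ?_, ?_⟩
  · have : |q*r| ≤ 9/2 := by rw [abs_le]; constructor <;> nlinarith [sq_nonneg (q+r), sq_nonneg (q-r)]
    rw [abs_le] at *; constructor <;> linarith
  · rw [abs_le] at *; constructor <;> nlinarith [sq_nonneg r]

lemma key_real (a b p q r H : ℝ) (ha : a ≠ 0) (hH : 0 < H) (h6 : |a*p^2| ≤ H) (h5 : |2*a*p*q| ≤ H)
    (h4 : |a*(q^2+2*p*r)| ≤ H)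
    (h3 : |2*a*q*r+b*p| ≤ H) (h2 : |a*r^2+b*q| ≤ H) (h1 : |b*r| ≤ H) :
    |a| *q^2 ≤ 5*H ∧ |a| *r^2 ≤ 4*H ∧ |b*p| ≤ 10*H ∧ |b*q| ≤ 5*H := by
  have ha' : 0 < |a| := abs_pos.2 ha
  obtain ⟨t, ht, htt⟩ : ∃ t : ℝ, 0 < t ∧ t^2 * |a| = H :=
    ⟨Real.sqrt (H/|a|), Real.sqrt_pos.2 (by positivity), by
      rw [Real.sq_sqrt (by positivity)]; field_simp⟩
  have conv : ∀ (x y k : ℝ), x = a * t^2 * y → (|x| ≤ k * H ↔ |y| ≤ k) := by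
    intro x y k hx
    have : |x| = H * |y| := by
      rw [hx, abs_mul, abs_mul, abs_of_pos (by positivity : 0 < t^2), ← htt]; ring
    rw [this, mul_comm k]
    exact mul_le_mul_iff_right₀ hH
  have := key_norm (p/t) (q/t) (r/t) (b/(a*t))
    ((conv (a*p^2) _ 1 (by field_simp)).1 (by simpa using h6))
    ((conv (2*a*p*q) _ 1 (by field_simp)).1 (by simpa using h5))
    ((conv (a*(q^2+2*p*r)) _ 1 (by field_simp)).1 (by simpa using h4))
    ((conv (2*a*q*r+b*p) _ 1 (by field_simp)).1 (by simpa using h3))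
    ((conv (a*r^2+b*q) _ 1 (by field_simp)).1 (by simpa using h2))
    ((conv (b*r) _ 1 (by field_simp)).1 (by simpa using h1))
  obtain ⟨k1, k2, k3, k4⟩ := this
  refine ⟨?_, ?_, ?_, ?_⟩
  · have := (conv (a*q^2) ((q/t)^2) 5 (by field_simp)).2 (by rwa [abs_of_nonneg (by positivity)])
    rwa [abs_mul, abs_of_nonneg (sq_nonneg q)] at this
  · have := (conv (a*r^2) ((r/t)^2) 4 (by field_simp)).2 (by rwa [abs_of_nonneg (by positivity)])
    rwa [abs_mul, abs_of_nonneg (sq_nonneg r)] at this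
  · exact (conv (b*p) _ 10 (by field_simp)).2 k3
  · exact (conv (b*q) _ 5 (by field_simp)).2 k4

lemma key_int (a b p q r H : ℤ) (ha : a ≠ 0) (hH : 0 < H) (h6 : |a*p^2| ≤ H) (h5 : |2*a*p*q| ≤ H)
    (h4 : |a*(q^2+2*p*r)| ≤ H)
    (h3 : |2*a*q*r+b*p| ≤ H) (h2 : |a*r^2+b*q| ≤ H) (h1 : |b*r| ≤ H) :
    |a| *q^2 ≤ 5*H ∧ |a| *r^2 ≤ 4*H ∧ |b*p| ≤ 10*H ∧ |b*q| ≤ 5*H := by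
  have := key_real a b p q r H (by exact_mod_cast ha) (by exact_mod_cast hH) (by exact_mod_cast h6)
    (by exact_mod_cast h5) (by exact_mod_cast h4) (by exact_mod_cast h3) (by exact_mod_cast h2)
    (by exact_mod_cast h1)
  exact_mod_cast this

/-- the polynomial with parameters -/
noncomputable def mkPoly (x : (ℤ × ℤ × ℤ) × ℤ × ℤ × ℤ) : ℤ[X] :=
  C x.2.1 * (C x.1.1 * X^3 + C x.1.2.1 * X^2 + C x.1.2.2 * X)^2
    + C x.2.2.1 * (C x.1.1 * X^3 + C x.1.2.1 * X^2 + C x.1.2.2 * X) + C x.2.2.2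

lemma mkPoly_eq (a b c p q r : ℤ) : mkPoly ((p,q,r),a,b,c) =
    C (a*p^2) * X^6 + C (2*a*p*q) * X^5 + C (a*(q^2+2*p*r)) * X^4 + C (2*a*q*r+b*p) * X^3
    + C (a*r^2+b*q) * X^2 + C (b*r) * X + C c := by
  simp only [mkPoly, map_add, map_mul, map_pow, map_ofNat]
  ring

/-- shell of triples of sup norm `M` -/
noncomputable def cube (M : ℕ) : Finset (ℤ × ℤ × ℤ) :=
  Finset.Icc (-(M:ℤ)) M ×ˢ Finset.Icc (-(M:ℤ)) M ×ˢ Finset.Icc (-(M:ℤ)) M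

lemma cube_card (M : ℕ) : (cube M).card = (2*M+1)^3 := by
  have : (Finset.Icc (-(M:ℤ)) M).card = 2*M+1 := by rw [Int.card_Icc]; omega
  simp only [cube, Finset.card_product, this]; ring

lemma mem_cube (M : ℕ) (p q r : ℤ) : (p,q,r) ∈ cube M ↔ |p| ≤ M ∧ |q| ≤ M ∧ |r| ≤ M := by
  simp [cube, abs_le]

noncomputable def shell (M : ℕ) : Finset (ℤ × ℤ × ℤ) := cube M \ cube (M-1)

lemma shell_card (M : ℕ) (hM : 1 ≤ M) : (shell M).card ≤ 26 * M^2 := by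
  obtain ⟨n, rfl⟩ := Nat.exists_eq_add_of_le' hM
  have hsub : cube n ⊆ cube (n+1) := by
    rintro ⟨p, q, r⟩ h
    rw [mem_cube] at *
    push_cast; omega
  rw [shell, Nat.add_sub_cancel, Finset.card_sdiff_of_subset hsub, cube_card, cube_card]
  rw [Nat.sub_le_iff_le_add]
  nlinarith

noncomputable def box (H M : ℕ) : Finset ((ℤ × ℤ × ℤ) × ℤ × ℤ × ℤ) :=
  shell M ×ˢ (Finset.Icc (-((5*H/M^2 : ℕ):ℤ)) (5*H/M^2 : ℕ)).erase 0 ×ˢ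
    Finset.Icc (-((10*H/M : ℕ):ℤ)) (10*H/M : ℕ) ×ˢ Finset.Icc (-(H:ℤ)) H

lemma box_card (H M : ℕ) (hH : 1 ≤ H) (hM : 1 ≤ M) (hM' : M ≤ 5*H) :
    ((box H M).card : ℝ) ≤ 19500 * (H:ℝ)^3 * (1/M) := by
  have h1 : ((shell M).card : ℝ) ≤ 26 * M^2 := by exact_mod_cast shell_card M hM
  have hM0 : (0:ℝ) < M := by exact_mod_cast hM
  have hH0 : (1:ℝ) ≤ H := by exact_mod_cast hH
  have h2 : (((Finset.Icc (-((5*H/M^2 : ℕ):ℤ)) (5*H/M^2 : ℕ)).erase 0).card : ℝ) ≤ 10*H/M^2 := by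
    have : ((Finset.Icc (-((5*H/M^2 : ℕ):ℤ)) (5*H/M^2 : ℕ)).erase 0).card = 2*(5*H/M^2) := by
      rw [Finset.card_erase_of_mem (by simp; positivity), Int.card_Icc]; omega
    rw [this]
    have := @Nat.cast_div_le ℝ _ _ _ (5*H) (M^2)
    push_cast at *
    calc (2:ℝ) * ((5*H/M^2 : ℕ):ℝ) ≤ 2 * (5*H/M^2) := by gcongr
      _ = _ := by ring
  have h3 : ((Finset.Icc (-((10*H/M : ℕ):ℤ)) (10*H/M : ℕ)).card : ℝ) ≤ 25*H/M := by
    have : (Finset.Icc (-((10*H/M : ℕ):ℤ)) (10*H/M : ℕ)).card = 2*(10*H/M)+1 := by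
      rw [Int.card_Icc]; omega
    rw [this]
    have := @Nat.cast_div_le ℝ _ _ _ (10*H) M
    have h' : (1:ℝ) ≤ 5*H/M := by
      rw [le_div_iff₀ hM0, one_mul]; exact_mod_cast hM'
    push_cast at *
    calc (2:ℝ) * ((10*H/M : ℕ):ℝ) + 1 ≤ 2 * (10*H/M) + 5*H/M := by gcongr
      _ = _ := by ring
  have h4 : ((Finset.Icc (-(H:ℤ)) H).card : ℝ) ≤ 3*H := by
    have : (Finset.Icc (-(H:ℤ)) H).card = 2*H+1 := by rw [Int.card_Icc]; omega
    rw [this]; push_cast; linarith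
  simp only [box, Finset.card_product, Nat.cast_mul]
  calc _ ≤ (26 * (M:ℝ)^2) * ((10*H/M^2) * ((25*H/M) * (3*H))) := by gcongr
    _ = _ := by field_simp; norm_num

noncomputable def bigSet (H : ℕ) : Finset ℤ[X] :=
  (Finset.Icc 1 (5*H)).biUnion fun M => (box H M).image mkPoly

lemma bigSet_card (H : ℕ) (hH : 2 ≤ H) :
    ((bigSet H).card : ℝ) ≤ 117000 * (H:ℝ)^3 * Real.log H := by
  have h1 : (bigSet H).card ≤ ∑ M ∈ Finset.Icc 1 (5*H), (box H M).card :=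
    Finset.card_biUnion_le.trans (Finset.sum_le_sum fun _ _ => Finset.card_image_le)
  have h2 : ((bigSet H).card : ℝ) ≤ ∑ M ∈ Finset.Icc 1 (5*H), 19500 * (H:ℝ)^3 * (1/(M:ℝ)) := by
    refine (Nat.cast_le.2 h1).trans ?_
    rw [Nat.cast_sum]
    refine Finset.sum_le_sum fun M hM => ?_
    rw [Finset.mem_Icc] at hM
    exact box_card H M (by omega) hM.1 hM.2
  rw [← Finset.mul_sum] at h2
  have h3 : ∑ M ∈ Finset.Icc 1 (5*H), (1/(M:ℝ)) ≤ 1 + Real.log (5*H) := by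
    have := harmonic_le_one_add_log (5*H)
    rw [harmonic_eq_sum_Icc] at this
    push_cast at this
    simpa using this
  have h4 : 1 + Real.log (5*H) ≤ 6 * Real.log H := by
    have hH' : (2:ℝ) ≤ H := by exact_mod_cast hH
    have h0 : Real.log 2 ≤ Real.log H := Real.log_le_log (by norm_num) hH'
    rw [Real.log_mul (by norm_num) (by positivity)]
    have h5 : Real.log 5 ≤ 3 * Real.log 2 := by
      have : 3 * Real.log 2 = Real.log (2^3) := by rw [Real.log_pow]; norm_num
      rw [this]
      exact Real.log_le_log (by norm_num) (by norm_num)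
    have := Real.log_two_gt_d9
    linarith
  calc _ ≤ _ := h2
    _ ≤ 19500 * (H:ℝ)^3 * (6 * Real.log H) := by gcongr; exact h3.trans h4
    _ = _ := by ring

lemma mem_bigSet (H : ℕ) (hH : 2 ≤ H) (f g h : ℤ[X]) (hf : HeightLe f H)
    (hg : g.natDegree = 2) (hh : h.natDegree = 3) (hfg : f = g.comp h) : f ∈ bigSet H := by
  obtain ⟨a, β, γ, ha, rfl⟩ : ∃ a β γ : ℤ, a ≠ 0 ∧ g = C a * X^2 + C β * X + C γ := by
    refine ⟨g.coeff 2, g.coeff 1, g.coeff 0, ?_, ?_⟩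
    · rw [← hg]; intro h0; rw [coeff_natDegree, leadingCoeff_eq_zero] at h0; simp [h0] at hg
    · conv_lhs => rw [g.as_sum_range_C_mul_X_pow, hg]
      simp [Finset.sum_range_succ]; ring
  obtain ⟨p, q, r, s, hp, rfl⟩ : ∃ p q r s : ℤ, p ≠ 0 ∧
      h = C p * X^3 + C q * X^2 + C r * X + C s := by
    refine ⟨h.coeff 3, h.coeff 2, h.coeff 1, h.coeff 0, ?_, ?_⟩
    · rw [← hh]; intro h0; rw [coeff_natDegree, leadingCoeff_eq_zero] at h0; simp [h0] at hh
    · conv_lhs => rw [h.as_sum_range_C_mul_X_pow, hh]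
      simp [Finset.sum_range_succ]; ring
  obtain ⟨b, c, rfl⟩ : ∃ b c : ℤ, f = mkPoly ((p,q,r),a,b,c) := by
    refine ⟨2*a*s+β, a*s^2+β*s+γ, ?_⟩
    rw [hfg]
    simp only [mkPoly, add_comp, mul_comp, C_comp, pow_comp, X_comp, map_add, map_mul, map_pow,
      map_ofNat]
    ring
  clear hfg hg hh
  have c6 := hf 6
  have c5 := hf 5
  have c4 := hf 4
  have c3 := hf 3
  have c2 := hf 2
  have c1 := hf 1
  have c0 := hf 0
  rw [mkPoly_eq] at c0 c1 c2 c3 c4 c5 c6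
  simp only [coeff_add, coeff_C_mul, coeff_X_pow, coeff_X, coeff_C] at c0 c1 c2 c3 c4 c5 c6
  norm_num at c0 c1 c2 c3 c4 c5 c6
  obtain ⟨k1, k2, k3, k4⟩ := key_int a b p q r H ha (by omega)
    (by simpa [abs_mul] using c6) (by simpa [abs_mul] using c5) (by simpa [abs_mul] using c4)
    c3 c2 (by simpa [abs_mul] using c1)
  have k5 : |a| * p^2 ≤ H := by simpa [abs_mul] using c6
  have k6 : |b*r| ≤ H := by simpa [abs_mul] using c1
  have hHZ : (2:ℤ) ≤ H := by exact_mod_cast hH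
  -- sup norm
  obtain ⟨M, hM, hMp, hMq, hMr, hMo⟩ : ∃ M : ℕ, 1 ≤ M ∧ |p| ≤ M ∧ |q| ≤ M ∧ |r| ≤ M ∧
      ((M:ℤ) = |p| ∨ (M:ℤ) = |q| ∨ (M:ℤ) = |r|) := by
    rw [Int.abs_eq_natAbs, Int.abs_eq_natAbs, Int.abs_eq_natAbs]
    refine ⟨max p.natAbs (max q.natAbs r.natAbs), ?_, ?_, ?_, ?_, ?_⟩ <;> omega
  have ha1 : 1 ≤ |a| := Int.one_le_abs ha
  have hMa : |a| * (M:ℤ)^2 ≤ 5*H := by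
    rcases hMo with h | h | h <;> rw [h, sq_abs] <;> linarith
  have hMb : |b| * (M:ℤ) ≤ 10*H := by
    rcases hMo with h | h | h <;> rw [h, ← abs_mul] <;> linarith
  have hMZ : (1:ℤ) ≤ M := by exact_mod_cast hM
  have hM5 : (M:ℤ) ≤ 5*H := by nlinarith
  rw [bigSet, Finset.mem_biUnion]
  refine ⟨M, Finset.mem_Icc.2 ⟨hM, by exact_mod_cast hM5⟩, Finset.mem_image_of_mem _ ?_⟩
  have A1 : |a| ≤ ((5*H/M^2 : ℕ):ℤ) := by
    push_cast
    exact (Int.le_ediv_iff_mul_le (by positivity)).2 hMa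
  have B1 : |b| ≤ ((10*H/M : ℕ):ℤ) := by
    push_cast
    exact (Int.le_ediv_iff_mul_le (by positivity)).2 hMb
  rw [box, Finset.mem_product, Finset.mem_product, Finset.mem_product]
  refine ⟨?_, ?_, ?_, ?_⟩
  · rw [shell, Finset.mem_sdiff, mem_cube, mem_cube]
    refine ⟨⟨hMp, hMq, hMr⟩, ?_⟩
    rintro ⟨x, y, z⟩
    omega
  · exact Finset.mem_erase.2 ⟨ha, Finset.mem_Icc.2 (abs_le.1 A1)⟩
  · exact Finset.mem_Icc.2 (abs_le.1 B1)
  · exact Finset.mem_Icc.2 (abs_le.1 c0)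

lemma indec_of_le (g : ℤ[X]) (h : g.natDegree ≤ 3) : ¬ Decomposable g := by
  rintro ⟨u, v, hu, hv, rfl⟩
  rw [natDegree_comp] at h
  nlinarith

theorem stmt_12 :
    ∃ c : ℝ, 0 < c ∧ ∀ H : ℕ, 2 ≤ H →
      |(DdStar 6 H : ℝ) - (IdStar 6 2 H : ℝ)| ≤ c * (H : ℝ) ^ 3 * Real.log H := by
  refine ⟨117000, by norm_num, fun H hH => ?_⟩
  refine le_trans ?_ (bigSet_card H hH)
  set D : Set ℤ[X] := {f | f.natDegree = 6 ∧ f ≠ 0 ∧ HeightLe f H ∧ Decomposable f} with hD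
  set I : Set ℤ[X] := {f | f.natDegree = 6 ∧ f ≠ 0 ∧ HeightLe f H ∧
    ∃ g h : ℤ[X], ¬ Decomposable g ∧ ¬ Decomposable h ∧
      g.natDegree = 6 / 2 ∧ h.natDegree = 2 ∧ f = g.comp h} with hI
  have e1 : DdStar 6 H = D.ncard := rfl
  have e2 : IdStar 6 2 H = I.ncard := rfl
  have hID : I ⊆ D := by
    rintro f ⟨h1, h2, h3, g, h, -, -, hg, hh, hf⟩
    exact ⟨h1, h2, h3, g, h, by omega, by omega, hf⟩
  have hDI : D ⊆ I ∪ (bigSet H : Set ℤ[X]) := by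
    rintro f ⟨h1, h2, h3, g, h, hg, hh, hf⟩
    have hm : g.natDegree * h.natDegree = 6 := by rw [← natDegree_comp, ← hf, h1]
    have hg3 : g.natDegree ≤ 3 := by nlinarith
    have hgc : g.natDegree = 2 ∨ g.natDegree = 3 := by omega
    rcases hgc with hg' | hg'
    · right
      exact mem_bigSet H hH f g h h3 hg' (by rw [hg'] at hm; omega) hf
    · left
      have hh' : h.natDegree = 2 := by rw [hg'] at hm; omega
      exact ⟨h1, h2, h3, g, h, indec_of_le g (by omega), indec_of_le h (by omega), hg', hh', hf⟩
  rw [e1, e2]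
  by_cases hfin : D.Finite
  · have l1 : I.ncard ≤ D.ncard := Set.ncard_le_ncard hID hfin
    have l2 : D.ncard ≤ I.ncard + (bigSet H).card := by
      have := Set.ncard_le_ncard hDI ((hfin.subset hID).union (Finset.finite_toSet _))
      have h2 := Set.ncard_union_le I (bigSet H : Set ℤ[X])
      rw [Set.ncard_coe_finset] at h2
      omega
    have l1' : (I.ncard : ℝ) ≤ D.ncard := by exact_mod_cast l1
    have l2' : (D.ncard : ℝ) ≤ I.ncard + (bigSet H).card := by exact_mod_cast l2
    rw [abs_of_nonneg (by linarith)]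
    linarith
  · have hfin' : ¬ I.Finite := fun hIf => hfin ((hIf.union (Finset.finite_toSet _)).subset hDI)
    rw [Set.Infinite.ncard hfin, Set.Infinite.ncard hfin']
    simp
end
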